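/- arXiv:2310.14464 — 6 statements merged into one kernel-verified Lean document; each statement's English description precedes it below -/
import Mathlib

section
/- Let n ≥ 1 and let X₁, …, Xₙ be independent standard Gaussian random variables, and set R = Σᵢ Xᵢ² (so R is chi-squared distributed with n degrees of freedom). Then for every x > 0, Pr[n − 2√(nx) ≤ R ≤ n + 2√(nx) + 2x] ≥ 1 − 2e^{−x}. -/
open MeasureTheory ProbabilityTheory Real

lemma aux_dens (t : ℝ) : (fun y : ℝ => gaussianPDFReal 0 1 y • exp (t * y ^ 2)) =
    fun y => (√(2 * π))⁻¹ * exp (-(1/2 - t) * y ^ 2) := by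
  funext y
  simp only [gaussianPDFReal, smul_eq_mul, NNReal.coe_one, mul_one, sub_zero]
  rw [mul_assoc, ← exp_add]
  congr 2
  ring

lemma aux_mgf (t : ℝ) (ht : t < 1/2) :
    ∫ y, exp (t * y ^ 2) ∂(gaussianReal 0 1) = √(1 / (1 - 2 * t)) := by
  rw [integral_gaussianReal_eq_integral_smul one_ne_zero, aux_dens,
    integral_const_mul, integral_gaussian, ← Real.sqrt_inv, ← Real.sqrt_mul (by positivity)]
  congr 1
  have h1 : 1 - 2 * t ≠ 0 := by linarith
  have h2 : 1 / 2 - t ≠ 0 := by intro h; apply h1; linarith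
  have := Real.pi_ne_zero
  field_simp

lemma aux_mgf_le (t c : ℝ) (ht : t < 1/2) (hc : - log (1 - 2 * t) ≤ 2 * c) :
    ∫ y, exp (t * y ^ 2) ∂(gaussianReal 0 1) ≤ exp c := by
  rw [aux_mgf t ht]
  apply Real.sqrt_le_iff.2 ⟨(exp_pos _).le, ?_⟩
  rw [← exp_nat_mul, one_div, ← Real.exp_log (show 0 < (1 - 2 * t)⁻¹ by
    apply inv_pos.2; linarith), Real.log_inv]
  exact exp_le_exp.2 (by push_cast; exact hc)

lemma aux_int (t : ℝ) (ht : t < 1/2) :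
    Integrable (fun y => exp (t * y ^ 2)) (gaussianReal 0 1) := by
  have h : 0 < √(1 / (1 - 2 * t)) := by
    apply Real.sqrt_pos.2
    apply one_div_pos.2
    linarith
  rw [← aux_mgf t ht] at h
  by_contra hh
  rw [integral_undef hh] at h
  exact lt_irrefl _ h

lemma aux_exp_sum (n : ℕ) (t : ℝ) : (fun ω : Fin n → ℝ => exp (t * ∑ i, (ω i) ^ 2)) =
    fun ω => ∏ i, exp (t * (ω i) ^ 2) := by
  funext ω
  rw [Finset.mul_sum, exp_sum]

lemma aux_int_pi (n : ℕ) (t : ℝ) (ht : t < 1/2) :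
    Integrable (fun ω : Fin n → ℝ => exp (t * ∑ i, (ω i) ^ 2))
      (Measure.pi fun _ : Fin n => gaussianReal 0 1) := by
  rw [aux_exp_sum]
  exact Integrable.fintype_prod (f := fun _ y => exp (t * y ^ 2)) (fun _ => aux_int t ht)

lemma aux_mgf_pi (n : ℕ) (t c : ℝ) (ht : t < 1/2) (hc : - log (1 - 2 * t) ≤ 2 * c) :
    mgf (fun ω : Fin n → ℝ => ∑ i, (ω i) ^ 2)
      (Measure.pi fun _ : Fin n => gaussianReal 0 1) t ≤ exp (n * c) := by
  unfold mgf
  rw [aux_exp_sum, integral_fintype_prod_eq_prod (fun _ y => exp (t * y ^ 2)), exp_nat_mul]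
  simp only [Finset.prod_const, Finset.card_univ, Fintype.card_fin]
  exact pow_le_pow_left₀ (integral_nonneg fun _ => (exp_pos _).le) (aux_mgf_le t c ht hc) n

lemma aux_log_up (u : ℝ) (h0 : 0 ≤ u) (h1 : u < 1) :
    - log (1 - u) ≤ u + u ^ 2 / (2 * (1 - u)) := by
  have hp : 0 < 1 - u := by linarith
  have hz : 0 ≤ - log (1 - u) := by
    have := Real.log_nonpos hp.le (by linarith)
    linarith
  have := Real.self_le_sinh_iff.2 hz
  refine this.trans (le_of_eq ?_)
  rw [Real.sinh_eq, neg_neg, Real.exp_neg, Real.exp_log hp]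
  field_simp
  ring

lemma aux_log_lo (s : ℝ) (h0 : 0 ≤ s) :
    - log (1 - 2 * (-s)) ≤ 2 * (-s + s ^ 2) := by
  have := Real.le_log_one_add_of_nonneg (show 0 ≤ 2 * s by linarith)
  have h2 : 2 * s - 2 * s ^ 2 ≤ 2 * (2 * s) / (2 * s + 2) := by
    rw [le_div_iff₀ (by linarith)]
    nlinarith [pow_nonneg h0 3]
  have h3 : 1 - 2 * (-s) = 1 + 2 * s := by ring
  rw [h3]
  linarith

/-- Laurent–Massart chi-squared concentration: for `n ≥ 1` i.i.d. standard Gaussians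
`X₁, …, Xₙ` with `R = Σᵢ Xᵢ²` (chi-squared with `n` degrees of freedom), for every `x > 0`,
`Pr[n − 2√(nx) ≤ R ≤ n + 2√(nx) + 2x] ≥ 1 − 2e^{−x}`. -/
theorem chi_squared_two_sided_concentration (n : ℕ) (hn : 1 ≤ n) (x : ℝ) (hx : 0 < x) :
    (Measure.pi fun _ : Fin n => gaussianReal 0 1)
      {ω | (n : ℝ) - 2 * Real.sqrt (n * x) ≤ ∑ i, (ω i) ^ 2 ∧
        ∑ i, (ω i) ^ 2 ≤ (n : ℝ) + 2 * Real.sqrt (n * x) + 2 * x} ≥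
      ENNReal.ofReal (1 - 2 * Real.exp (-x)) := by
  set μ := (Measure.pi fun _ : Fin n => gaussianReal 0 1) with hμ
  have hn' : (0 : ℝ) < n := by exact_mod_cast hn
  obtain ⟨a, ha, hna⟩ : ∃ a : ℝ, 0 < a ∧ (n : ℝ) = a ^ 2 :=
    ⟨√n, Real.sqrt_pos.2 hn', (Real.sq_sqrt hn'.le).symm⟩
  obtain ⟨b, hb, hxb⟩ : ∃ b : ℝ, 0 < b ∧ x = b ^ 2 :=
    ⟨√x, Real.sqrt_pos.2 hx, (Real.sq_sqrt hx.le).symm⟩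
  have hs : √((n : ℝ) * x) = a * b := by
    rw [hna, hxb, ← mul_pow, Real.sqrt_sq (by positivity)]
  rw [hs]
  have hup : μ.real {ω | (n : ℝ) + 2 * (a * b) + 2 * x ≤ ∑ i, (ω i) ^ 2} ≤ exp (-x) := by
    have ht : b / (a + 2 * b) < 1 / 2 := by
      rw [div_lt_div_iff₀ (by positivity) (by positivity)]; linarith
    have ht0 : 0 ≤ b / (a + 2 * b) := by positivity
    have h1 := measure_ge_le_exp_mul_mgf (μ := μ) (X := fun ω : Fin n → ℝ => ∑ i, (ω i) ^ 2)
      ((n : ℝ) + 2 * (a * b) + 2 * x) ht0 (aux_int_pi n _ ht)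
    have h2 := aux_mgf_pi n (b / (a + 2 * b))
      (b / (a + 2 * b) + (b / (a + 2 * b)) ^ 2 / (1 - 2 * (b / (a + 2 * b)))) ht (by
        have := aux_log_up (2 * (b / (a + 2 * b))) (by linarith) (by linarith)
        refine this.trans (le_of_eq ?_)
        have : 1 - 2 * (b / (a + 2 * b)) ≠ 0 := by linarith
        generalize b / (a + 2 * b) = t at *
        field_simp)
    refine h1.trans ((mul_le_mul_of_nonneg_left h2 (exp_pos _).le).trans (le_of_eq ?_))
    rw [← exp_add]
    congr 1
    have : 1 - 2 * (b / (a + 2 * b)) = a / (a + 2 * b) := by field_simp; ring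
    rw [this, hna, hxb]
    field_simp
    ring
  have hlo : μ.real {ω | ∑ i, (ω i) ^ 2 ≤ (n : ℝ) - 2 * (a * b)} ≤ exp (-x) := by
    have ht0 : 0 ≤ b / a := by positivity
    have ht : -(b / a) < 1 / 2 := by linarith
    have h1 := measure_le_le_exp_mul_mgf (μ := μ) (X := fun ω : Fin n → ℝ => ∑ i, (ω i) ^ 2)
      ((n : ℝ) - 2 * (a * b)) (neg_nonpos.2 ht0) (aux_int_pi n _ ht)
    have h2 := aux_mgf_pi n (-(b / a)) _ ht (aux_log_lo _ ht0)
    refine h1.trans ((mul_le_mul_of_nonneg_left h2 (exp_pos _).le).trans (le_of_eq ?_))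
    rw [← exp_add]
    congr 1
    rw [hna, hxb]
    field_simp
    ring
  set S := {ω : Fin n → ℝ | (n : ℝ) - 2 * (a * b) ≤ ∑ i, (ω i) ^ 2 ∧
        ∑ i, (ω i) ^ 2 ≤ (n : ℝ) + 2 * (a * b) + 2 * x} with hS
  have hcov : (Set.univ : Set (Fin n → ℝ)) ⊆ S ∪
      ({ω | (n : ℝ) + 2 * (a * b) + 2 * x ≤ ∑ i, (ω i) ^ 2} ∪
       {ω | ∑ i, (ω i) ^ 2 ≤ (n : ℝ) - 2 * (a * b)}) := by
    intro ω _
    simp only [hS, Set.mem_union, Set.mem_setOf_eq]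
    rcases le_total ((n : ℝ) - 2 * (a * b)) (∑ i, (ω i) ^ 2) with h | h
    · rcases le_total (∑ i, (ω i) ^ 2) ((n : ℝ) + 2 * (a * b) + 2 * x) with h' | h'
      · exact Or.inl ⟨h, h'⟩
      · exact Or.inr (Or.inl h')
    · exact Or.inr (Or.inr h)
  have h1 := measureReal_mono (μ := μ) hcov
  have h2 := h1.trans ((measureReal_union_le _ _).trans
    (add_le_add_right (measureReal_union_le _ _) _))
  rw [probReal_univ] at h2
  change ENNReal.ofReal _ ≤ μ S
  apply ENNReal.ofReal_le_of_le_toReal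
  change _ ≤ μ.real S
  linarith
end

section
/- Let n ≥ 1 and let X₁, …, Xₙ be independent standard Gaussian random variables, and set R = Σᵢ Xᵢ². Then for every x > 0, Pr[R ≥ n + 2√(nx) + 2x] ≤ e^{−x}. -/
open MeasureTheory ProbabilityTheory Real

lemma chi_aux_int (w : ℝ) (hw : 0 < w) (t : ℝ) (ht : 1 / 2 - t = 1 / (2 * w)) :
    ∫ y, Real.exp (t * y ^ 2) ∂(gaussianReal 0 1) = Real.sqrt w := by
  rw [integral_gaussianReal_eq_integral_smul (by simp)]
  have h : ∀ y : ℝ, gaussianPDFReal 0 1 y • Real.exp (t * y ^ 2)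
      = (Real.sqrt (2 * π))⁻¹ * Real.exp (-(1 / (2 * w)) * y ^ 2) := by
    intro y
    rw [gaussianPDFReal_def, ← ht]
    simp only [NNReal.coe_one, mul_one, smul_eq_mul, sub_zero]
    rw [mul_assoc, ← Real.exp_add]
    congr 2
    ring
  simp_rw [h]
  rw [integral_const_mul, integral_gaussian]
  have : π / (1 / (2 * w)) = (2 * π) * w := by field_simp
  rw [this, Real.sqrt_mul (by positivity : 0 ≤ 2 * π) w]
  have : 0 < Real.sqrt (2 * π) := by positivity
  field_simp

lemma chi_aux_sqrt (s : ℝ) (hs : 0 < s) :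
    Real.sqrt (1 + 2 * s) ≤ Real.exp ((s + s ^ 2) / (1 + 2 * s)) := by
  have hw : 0 < 1 + 2 * s := by positivity
  have h := Real.self_le_sinh_iff.2 (Real.log_nonneg (by linarith : 1 ≤ 1 + 2 * s))
  rw [Real.sinh_eq, Real.exp_neg, Real.exp_log hw] at h
  have e : (1 + 2 * s - (1 + 2 * s)⁻¹) / 2 = 2 * ((s + s ^ 2) / (1 + 2 * s)) := by
    field_simp
    ring
  rw [e] at h
  rw [Real.sqrt_le_left (by positivity), ← Real.exp_nat_mul, ← Real.log_le_iff_le_exp hw]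
  exact_mod_cast h

/-- Laurent–Massart upper tail: for `n ≥ 1` i.i.d. standard Gaussians `X₁, …, Xₙ` with
`R = Σᵢ Xᵢ²` (chi-squared with `n` degrees of freedom), for every `x > 0`,
`Pr[R ≥ n + 2√(nx) + 2x] ≤ e^{−x}`. -/
theorem chi_squared_upper_tail (n : ℕ) (hn : 1 ≤ n) (x : ℝ) (hx : 0 < x) :
    (Measure.pi fun _ : Fin n => gaussianReal 0 1)
      {ω | (n : ℝ) + 2 * Real.sqrt (n * x) + 2 * x ≤ ∑ i, (ω i) ^ 2} ≤
      ENNReal.ofReal (Real.exp (-x)) := by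
  have hn0 : (0 : ℝ) < n := by exact_mod_cast hn
  obtain ⟨s, hs, hxs⟩ : ∃ s : ℝ, 0 < s ∧ x = n * s ^ 2 := by
    refine ⟨Real.sqrt (x / n), by positivity, ?_⟩
    rw [Real.sq_sqrt (by positivity)]
    field_simp
  have hsq : Real.sqrt (n * x) = n * s := by
    rw [hxs, show (n : ℝ) * (n * s ^ 2) = (n * s) ^ 2 by ring, Real.sqrt_sq (by positivity)]
  have hw : 0 < 1 + 2 * s := by positivity
  set t : ℝ := s / (1 + 2 * s) with ht
  have hI := chi_aux_int (1 + 2 * s) hw t (by rw [ht]; field_simp; ring)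
  have hmgf : mgf (fun ω : Fin n → ℝ => ∑ i, (ω i) ^ 2)
      (Measure.pi fun _ : Fin n => gaussianReal 0 1) t = Real.sqrt (1 + 2 * s) ^ n := by
    simp only [mgf, Finset.mul_sum, Real.exp_sum]
    rw [integral_fintype_prod_eq_pow (fun y : ℝ => Real.exp (t * y ^ 2)), hI, Fintype.card_fin]
  have hint : Integrable (fun ω : Fin n → ℝ => Real.exp (t * ∑ i, (ω i) ^ 2))
      (Measure.pi fun _ : Fin n => gaussianReal 0 1) := by
    by_contra hc
    have h0 := integral_undef hc
    have : Real.sqrt (1 + 2 * s) ^ n = 0 := hmgf.symm.trans h0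
    have : 0 < Real.sqrt (1 + 2 * s) ^ n := by positivity
    linarith
  have key := measure_ge_le_exp_mul_mgf ((n : ℝ) + 2 * Real.sqrt (n * x) + 2 * x)
    (by positivity : 0 ≤ t) hint
  rw [hmgf] at key
  rw [← ofReal_measureReal]
  refine ENNReal.ofReal_le_ofReal (key.trans ?_)
  calc _ ≤ Real.exp (-t * ((n : ℝ) + 2 * Real.sqrt (n * x) + 2 * x)) *
        Real.exp ((s + s ^ 2) / (1 + 2 * s)) ^ n := by
        gcongr
        exact chi_aux_sqrt s hs
    _ = Real.exp (-x) := by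
        rw [← Real.exp_nat_mul, ← Real.exp_add, hsq, hxs, ht]
        congr 1
        field_simp
        ring
end

section
/- Let n ≥ 1 and let X₁, …, Xₙ be independent standard Gaussian random variables, and set R = Σᵢ Xᵢ². Then for every x > 0, Pr[R ≤ n − 2√(nx)] ≤ e^{−x}. -/
open MeasureTheory ProbabilityTheory Real

lemma aux_mgf_s2 (s : ℝ) (hs : 0 < s) :
    ∫ y, Real.exp (-s * y ^ 2) ∂(gaussianReal 0 1) ≤ Real.exp (-s + s ^ 2) := by
  have h1 : ∫ y, Real.exp (-s * y ^ 2) ∂(gaussianReal 0 1) = (√(1 + 2 * s))⁻¹ := by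
    rw [integral_gaussianReal_eq_integral_smul one_ne_zero]
    have : ∀ y : ℝ, gaussianPDFReal 0 1 y • Real.exp (-s * y ^ 2)
        = (√(2 * π))⁻¹ * Real.exp (-(s + 1 / 2) * y ^ 2) := by
      intro y
      simp only [gaussianPDFReal, smul_eq_mul, NNReal.coe_one, mul_one, sub_zero]
      rw [mul_assoc, ← Real.exp_add]
      congr 2
      ring
    simp_rw [this]
    rw [integral_const_mul, integral_gaussian, ← Real.sqrt_inv, ← Real.sqrt_inv,
      ← Real.sqrt_mul (by positivity)]
    congr 1
    have := Real.pi_pos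
    field_simp
    ring
  rw [h1]
  have h2 := Real.le_log_one_add_of_nonneg (x := 2 * s) (by positivity)
  have h3 : 2 * s - 2 * s ^ 2 ≤ 2 * (2 * s) / (2 * s + 2) := by
    rw [le_div_iff₀ (by positivity)]
    nlinarith [pow_pos hs 3]
  have hp : 0 < 1 + 2 * s := by positivity
  have h4 : (√(1 + 2 * s))⁻¹ = Real.exp (-(Real.log (1 + 2 * s) / 2)) := by
    rw [Real.exp_neg, Real.exp_half, Real.exp_log hp]
  rw [h4]
  apply Real.exp_le_exp.mpr
  linarith

/-- Laurent–Massart lower tail: for `n ≥ 1` i.i.d. standard Gaussians `X₁, …, Xₙ` with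
`R = Σᵢ Xᵢ²` (chi-squared with `n` degrees of freedom), for every `x > 0`,
`Pr[R ≤ n − 2√(nx)] ≤ e^{−x}`. -/
theorem chi_squared_lower_tail (n : ℕ) (hn : 1 ≤ n) (x : ℝ) (hx : 0 < x) :
    (Measure.pi fun _ : Fin n => gaussianReal 0 1)
      {ω | ∑ i, (ω i) ^ 2 ≤ (n : ℝ) - 2 * Real.sqrt (n * x)} ≤
      ENNReal.ofReal (Real.exp (-x)) := by
  have hn' : (0 : ℝ) < n := by exact_mod_cast hn
  set s : ℝ := √(x / n) with hsdef
  have hs : 0 < s := Real.sqrt_pos.mpr (by positivity)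
  have hs2 : n * s ^ 2 = x := by
    rw [hsdef, Real.sq_sqrt (by positivity)]; field_simp
  have hsn : √(n * x) = n * s := by
    rw [← hs2, show (n : ℝ) * (n * s ^ 2) = (n * s) ^ 2 by ring, Real.sqrt_sq (by positivity)]
  set μ := Measure.pi fun _ : Fin n => gaussianReal 0 1 with hμ
  have hint : Integrable (fun ω : Fin n → ℝ => Real.exp (-s * ∑ i, (ω i) ^ 2)) μ := by
    refine Integrable.of_bound (Measurable.aestronglyMeasurable (by fun_prop)) 1 (ae_of_all _ fun ω => ?_)
    rw [Real.norm_eq_abs, Real.abs_exp, Real.exp_le_one_iff]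
    have : 0 ≤ ∑ i, (ω i) ^ 2 := Finset.sum_nonneg fun i _ => sq_nonneg _
    nlinarith
  have key := measure_le_le_exp_mul_mgf (μ := μ) (X := fun ω : Fin n → ℝ => ∑ i, (ω i) ^ 2)
    (t := -s) ((n : ℝ) - 2 * √(n * x)) (by linarith) hint
  have hm : mgf (fun ω : Fin n → ℝ => ∑ i, (ω i) ^ 2) μ (-s) ≤ Real.exp (n * (-s + s ^ 2)) := by
    unfold mgf
    simp_rw [Finset.mul_sum, Real.exp_sum]
    rw [hμ, integral_fintype_prod_eq_prod (f := fun (_ : Fin n) y => Real.exp (-s * y ^ 2)),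
      Finset.prod_const, Finset.card_univ, Fintype.card_fin, Real.exp_nat_mul]
    exact pow_le_pow_left₀ (integral_nonneg fun _ => (Real.exp_pos _).le) (aux_mgf_s2 s hs) n
  rw [← ofReal_measureReal]
  apply ENNReal.ofReal_le_ofReal
  refine key.trans ((mul_le_mul_of_nonneg_left hm (Real.exp_pos _).le).trans ?_)
  rw [← Real.exp_add, Real.exp_le_exp, hsn]
  nlinarith
end

section
/- Let n ≥ 1 be such that 2ⁿ ≥ 64n, and set N = 2ⁿ. Let (g_x)_{x ∈ Fin N} and (h_x)_{x ∈ Fin N} be 2N independent standard Gaussian random variables, set G = Σ_x g_x², H = Σ_x h_x², and define the random probability vector p on Fin N by p(x) = (g_x² + h_x²)/(G + H) (well-defined almost surely since G + H > 0 almost surely). Then E[Σ_{x ∈ Fin N} p(x)²] ≤ 50 · 2^{−n}. -/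
open MeasureTheory ProbabilityTheory Real

lemma aux_x4 (x : ℝ) : x ^ 4 ≤ 24 * (Real.cosh x - 1 - x ^ 2 / 2) := by
  have h := sum_le_hasSum (Finset.range 3) (fun i _ => by
    have : 0 ≤ x ^ (2 * i) := by rw [pow_mul]; positivity
    positivity) (Real.hasSum_cosh x)
  norm_num [Finset.sum_range_succ, Nat.factorial] at h
  linarith

lemma aux_int_s6 (k : ℕ) : Integrable (fun x : ℝ => x ^ k) (gaussianReal 0 1) := by
  have h := (memLp_id_gaussianReal' (μ := 0) (v := 1) (k : ENNReal) (by simp)).integrable_norm_pow'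
  refine (integrable_norm_iff (by fun_prop)).1 ?_
  simpa [norm_pow] using h

lemma aux_sq : ∫ x : ℝ, x ^ 2 ∂(gaussianReal 0 1) = 1 := by
  have h := variance_fun_id_gaussianReal (μ := 0) (v := 1)
  rw [variance_eq_integral (by fun_prop)] at h
  simpa using h

lemma aux_m4 : ∫ x : ℝ, x ^ 4 ∂(gaussianReal 0 1) ≤ 6 := by
  have e1 := congrFun (mgf_id_gaussianReal (μ := 0) (v := 1)) 1
  have e2 := congrFun (mgf_id_gaussianReal (μ := 0) (v := 1)) (-1)
  have i1 := integrable_exp_mul_gaussianReal (μ := 0) (v := 1) 1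
  have i2 := integrable_exp_mul_gaussianReal (μ := 0) (v := 1) (-1)
  simp [mgf] at e1 e2 i1 i2
  have hc : Integrable Real.cosh (gaussianReal 0 1) := by
    rw [show Real.cosh = fun x => (Real.exp x + Real.exp (-x)) / 2 from
      funext Real.cosh_eq]
    exact (i1.add i2).div_const 2
  have hE : ∫ x, Real.cosh x ∂(gaussianReal 0 1) = Real.exp (1/2) := by
    simp_rw [Real.cosh_eq]
    rw [integral_div, integral_add i1 i2, e1, e2]
    norm_num
  have h2 := aux_int_s6 2
  have hle : ∫ x : ℝ, x ^ 4 ∂(gaussianReal 0 1) ≤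
      ∫ x, 24 * (Real.cosh x - 1 - x ^ 2 / 2) ∂(gaussianReal 0 1) :=
    integral_mono (aux_int_s6 4) (((hc.sub (integrable_const 1)).sub (h2.div_const 2)).const_mul 24)
      aux_x4
  have hc1 : Integrable (fun x => Real.cosh x - 1) (gaussianReal 0 1) :=
    hc.sub (integrable_const 1)
  rw [integral_const_mul, integral_sub hc1 (h2.div_const 2),
    integral_sub hc (integrable_const 1), integral_div, aux_sq, hE] at hle
  have he : Real.exp (1/2) ≤ 7 / 4 := by
    have h1 : Real.exp (1/2) ^ 2 = Real.exp 1 := by rw [← Real.exp_nat_mul]; norm_num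
    nlinarith [Real.exp_one_lt_d9, Real.exp_pos (1/2)]
  simp at hle he
  linarith

lemma aux_memLp : MemLp (fun x : ℝ => x ^ 2) 2 (gaussianReal 0 1) := by
  rw [memLp_two_iff_integrable_sq (by fun_prop)]
  simpa [← pow_mul] using aux_int_s6 4

lemma aux_var : Var[fun x : ℝ => x ^ 2; gaussianReal 0 1] ≤ 5 := by
  rw [variance_eq_sub aux_memLp]
  have : ((fun x : ℝ => x ^ 2) ^ 2) = fun x : ℝ => x ^ 4 := by
    ext x; simp [← pow_mul]
  rw [this, aux_sq]
  linarith [aux_m4]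

noncomputable def auxF (N : ℕ) (g : Fin N → ℝ) : ℝ :=
  2 * ∑ x, g x ^ 4 + 2 * (∑ x, g x ^ 2 - N) ^ 2

lemma auxF_int (N : ℕ) :
    Integrable (auxF N) (Measure.pi fun _ : Fin N => gaussianReal 0 1) ∧
    ∫ g, auxF N g ∂(Measure.pi fun _ : Fin N => gaussianReal 0 1) ≤ 22 * N := by
  set μ := Measure.pi fun _ : Fin N => gaussianReal 0 1 with hμ
  have mp (x : Fin N) : MeasurePreserving (fun g : Fin N → ℝ => g x) μ (gaussianReal 0 1) :=
    measurePreserving_eval (fun _ : Fin N => gaussianReal 0 1) x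
  have i4 (x : Fin N) : Integrable (fun g : Fin N → ℝ => g x ^ 4) μ :=
    (mp x).integrable_comp_of_integrable (aux_int_s6 4)
  have i2 (x : Fin N) : Integrable (fun g : Fin N → ℝ => g x ^ 2) μ :=
    (mp x).integrable_comp_of_integrable (aux_int_s6 2)
  have ml (x : Fin N) : MemLp (fun g : Fin N → ℝ => g x ^ 2) 2 μ :=
    aux_memLp.comp_measurePreserving (mp x)
  have e4 (x : Fin N) : ∫ g : Fin N → ℝ, g x ^ 4 ∂μ ≤ 6 := by
    have := integral_map (μ := μ) (φ := fun g : Fin N → ℝ => g x) (f := fun y : ℝ => y ^ 4)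
      (mp x).aemeasurable (by fun_prop)
    rw [← this, (mp x).map_eq]; exact aux_m4
  have e2 (x : Fin N) : ∫ g : Fin N → ℝ, g x ^ 2 ∂μ = 1 := by
    have := integral_map (μ := μ) (φ := fun g : Fin N → ℝ => g x) (f := fun y : ℝ => y ^ 2)
      (mp x).aemeasurable (by fun_prop)
    rw [← this, (mp x).map_eq]; exact aux_sq
  have s4 : Integrable (fun g : Fin N → ℝ => ∑ x, g x ^ 4) μ :=
    integrable_finsetSum _ fun x _ => i4 x
  have sml : MemLp (fun g : Fin N → ℝ => ∑ x, g x ^ 2) 2 μ :=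
    memLp_finsetSum _ fun x _ => ml x
  have iV : Integrable (fun g : Fin N → ℝ => (∑ x, g x ^ 2 - (N : ℝ)) ^ 2) μ :=
    (sml.sub (memLp_const (N : ℝ))).integrable_sq
  have hm : ∫ g : Fin N → ℝ, ∑ x, g x ^ 2 ∂μ = N := by
    rw [integral_finsetSum _ fun x _ => i2 x]; simp [e2]
  have hV : ∫ g : Fin N → ℝ, (∑ x, g x ^ 2 - (N : ℝ)) ^ 2 ∂μ ≤ 5 * N := by
    have h := variance_sum_pi (μ := fun _ : Fin N => gaussianReal 0 1)
      (X := fun _ y => y ^ 2) (fun _ => aux_memLp)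
    have hs : (∑ i : Fin N, fun ω : Fin N → ℝ => ω i ^ 2) = fun ω => ∑ i, ω i ^ 2 := by
      ext; simp
    rw [hs, ← hμ, variance_eq_integral sml.1.aemeasurable, hm] at h
    rw [h]
    calc _ ≤ ∑ _i : Fin N, (5 : ℝ) := Finset.sum_le_sum fun _ _ => aux_var
      _ = _ := by simp [mul_comm]
  refine ⟨(s4.const_mul 2).add (iV.const_mul 2), ?_⟩
  unfold auxF
  rw [integral_add (s4.const_mul 2) (iV.const_mul 2), integral_const_mul, integral_const_mul,
    integral_finsetSum _ fun x _ => i4 x]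
  have : ∑ x : Fin N, ∫ g : Fin N → ℝ, g x ^ 4 ∂μ ≤ 6 * N := by
    calc _ ≤ ∑ _i : Fin N, (6 : ℝ) := Finset.sum_le_sum fun x _ => e4 x
      _ = _ := by simp [mul_comm]
  linarith

lemma aux_pt (N : ℕ) (hN : 0 < N) (g h : Fin N → ℝ) :
    ∑ x : Fin N, ((g x ^ 2 + h x ^ 2) / ((∑ y : Fin N, g y ^ 2) + ∑ y : Fin N, h y ^ 2)) ^ 2 ≤
      (auxF N g + auxF N h) / (N : ℝ) ^ 2 := by
  have hN' : (0 : ℝ) < N := by exact_mod_cast hN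
  set G := ∑ y : Fin N, g y ^ 2 with hG
  set H := ∑ y : Fin N, h y ^ 2 with hH
  have hG0 : 0 ≤ G := Finset.sum_nonneg fun _ _ => sq_nonneg _
  have hH0 : 0 ≤ H := Finset.sum_nonneg fun _ _ => sq_nonneg _
  have hg4 : 0 ≤ ∑ y : Fin N, g y ^ 4 := Finset.sum_nonneg fun _ _ => by positivity
  have hh4 : 0 ≤ ∑ y : Fin N, h y ^ 4 := Finset.sum_nonneg fun _ _ => by positivity
  have hS : ∑ x : Fin N, (g x ^ 2 + h x ^ 2) = G + H := Finset.sum_add_distrib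
  simp_rw [div_pow]
  rw [← Finset.sum_div]
  have h1 : ∑ x : Fin N, (g x ^ 2 + h x ^ 2) ^ 2 ≤
      2 * ∑ x, g x ^ 4 + 2 * ∑ x, h x ^ 4 := by
    rw [Finset.mul_sum, Finset.mul_sum, ← Finset.sum_add_distrib]
    exact Finset.sum_le_sum fun x _ => by nlinarith [sq_nonneg (g x ^ 2 - h x ^ 2)]
  have h2 : ∑ x : Fin N, (g x ^ 2 + h x ^ 2) ^ 2 ≤ (G + H) ^ 2 := by
    rw [← hS]
    exact Finset.sum_sq_le_sq_sum_of_nonneg fun _ _ => by positivity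
  unfold auxF
  rw [← hG, ← hH]
  rcases le_or_gt (N : ℝ) (G + H) with hc | hc
  · apply div_le_div₀ (by positivity) _ (by positivity) (by gcongr)
    nlinarith [sq_nonneg (G - N), sq_nonneg (H - N)]
  · calc _ ≤ (1 : ℝ) := div_le_one_of_le₀ h2 (by positivity)
      _ ≤ _ := by
        rw [one_le_div (by positivity)]
        nlinarith [sq_nonneg (G - H)]

/-- For `n ≥ 1` with `2ⁿ ≥ 64n`, `N = 2ⁿ`, and `2N` i.i.d. standard Gaussians `(g_x)`, `(h_x)`
with `G = Σ_x g_x²`, `H = Σ_x h_x²`, the random probability vector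
`p(x) = (g_x² + h_x²)/(G + H)` satisfies `E[Σ_x p(x)²] ≤ 50 · 2^{−n}`. -/
theorem expectation_collision_prob_haar (n N : ℕ) (hn : 1 ≤ n) (hN : N = 2 ^ n)
    (h64 : 64 * n ≤ 2 ^ n) :
    ∫ ω, (∑ x : Fin N,
        (((ω.1 x) ^ 2 + (ω.2 x) ^ 2) /
          ((∑ y : Fin N, (ω.1 y) ^ 2) + ∑ y : Fin N, (ω.2 y) ^ 2)) ^ 2)
      ∂((Measure.pi fun _ : Fin N => gaussianReal 0 1).prod
          (Measure.pi fun _ : Fin N => gaussianReal 0 1)) ≤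
      50 * ((2 : ℝ) ^ n)⁻¹ := by
  subst hN
  have hpos : 0 < 2 ^ n := by positivity
  obtain ⟨hi, hb⟩ := auxF_int (2 ^ n)
  set μ := Measure.pi fun _ : Fin (2 ^ n) => gaussianReal 0 1 with hμ
  have j1 : Integrable (fun ω : (Fin (2 ^ n) → ℝ) × (Fin (2 ^ n) → ℝ) => auxF (2 ^ n) ω.1)
      (μ.prod μ) := hi.comp_fst μ
  have j2 : Integrable (fun ω : (Fin (2 ^ n) → ℝ) × (Fin (2 ^ n) → ℝ) => auxF (2 ^ n) ω.2)
      (μ.prod μ) := hi.comp_snd μ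
  refine (integral_mono_of_nonneg (Filter.Eventually.of_forall fun ω =>
    Finset.sum_nonneg fun _ _ => sq_nonneg _) ((j1.add j2).div_const _)
    (Filter.Eventually.of_forall fun ω => aux_pt (2 ^ n) hpos ω.1 ω.2)).trans ?_
  simp only [Pi.add_apply]
  rw [integral_div, integral_add j1 j2, integral_fun_fst, integral_fun_snd]
  simp only [probReal_univ, one_smul]
  push_cast at hb ⊢
  have h2 : (0 : ℝ) < 2 ^ n := by positivity
  rw [div_le_iff₀ (by positivity)]
  have : 50 * ((2 : ℝ) ^ n)⁻¹ * ((2 : ℝ) ^ n) ^ 2 = 50 * 2 ^ n := by field_simp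
  rw [this]
  linarith
end

section
/- Let n ≥ 1 be such that 2ⁿ ≥ 64n, set N = 2ⁿ, and let m ≥ 1. Let (g_x)_{x ∈ Fin N} and (h_x)_{x ∈ Fin N} be 2N independent standard Gaussian random variables, set G = Σ_x g_x², H = Σ_x h_x², and define the random probability vector p on Fin N by p(x) = (g_x² + h_x²)/(G + H). Then with probability at least 1 − 2^{−n/2} over the Gaussians, the following holds: if z₁, …, z_m are independent samples each distributed according to p, then Pr[∃ i ≠ j : zᵢ = zⱼ] ≤ 50 · m² · 2^{−n/2}. -/
open MeasureTheory ProbabilityTheory Real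
open scoped ENNReal

lemma gauss_mom : (∫ x, x^2 ∂gaussianReal 0 1 = 1) ∧ (∫ x, x^4 ∂gaussianReal 0 1 = 3) := by
  have h0 : (0:ℝ) ∈ interior (integrableExpSet id (gaussianReal 0 1)) := by simp [integrableExpSet_id_gaussianReal]
  have h1 : deriv (fun t : ℝ => rexp (t^2/2)) = fun t => t * rexp (t^2/2) := by
    funext t
    have : HasDerivAt (fun t : ℝ => rexp (t^2/2)) (rexp (t^2/2) * ((2:ℕ) * t^(2-1) /2)) t :=
      ((hasDerivAt_pow 2 t).div_const 2).exp
    rw [this.deriv]; push_cast; ring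
  have hd : ∀ t : ℝ, HasDerivAt (fun t : ℝ => rexp (t^2/2)) (t * rexp (t^2/2)) t := by
    intro t
    have : HasDerivAt (fun t : ℝ => rexp (t^2/2)) (rexp (t^2/2) * ((2:ℕ) * t^(2-1) /2)) t :=
      ((hasDerivAt_pow 2 t).div_const 2).exp
    convert this using 1; push_cast; ring
  have h2 : deriv (fun t : ℝ => t * rexp (t^2/2)) = fun t => (1+t^2) * rexp (t^2/2) := by
    funext t
    refine ((hasDerivAt_id' t).mul (hd t)).deriv.trans ?_; ring
  have h3 : deriv (fun t : ℝ => (1+t^2) * rexp (t^2/2)) = fun t => (3*t+t^3) * rexp (t^2/2) := by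
    funext t
    refine (((hasDerivAt_pow 2 t).const_add 1).mul (hd t)).deriv.trans ?_; push_cast; ring
  have h4 : deriv (fun t : ℝ => (3*t+t^3) * rexp (t^2/2)) = fun t => (3+6*t^2+t^4) * rexp (t^2/2) := by
    funext t
    refine ((((hasDerivAt_id' t).const_mul 3).add (hasDerivAt_pow 3 t)).mul (hd t)).deriv.trans ?_
    simp only [Pi.add_apply]; push_cast; ring
  have hm : mgf id (gaussianReal 0 1) = fun t : ℝ => rexp (t^2/2) := by
    rw [mgf_id_gaussianReal]; simp
  constructor
  · have := iteratedDeriv_mgf_zero h0 2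
    rw [hm] at this
    simp only [iteratedDeriv_succ, iteratedDeriv_zero, h1, h2] at this
    simpa using this.symm
  · have := iteratedDeriv_mgf_zero h0 4
    rw [hm] at this
    simp only [iteratedDeriv_succ, iteratedDeriv_zero, h1, h2, h3, h4] at this
    simpa using this.symm

lemma gauss_int4 : Integrable (fun x : ℝ => x^4) (gaussianReal 0 1) := by
  have := (memLp_id_gaussianReal (μ := 0) (v := 1) 4).integrable_norm_pow (p := 4) (by norm_num)
  refine this.congr (Filter.Eventually.of_forall fun x => ?_)
  simp [Even.pow_abs (n := 4) (by decide)]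

lemma gauss_memLp : MemLp (fun x : ℝ => x^2) 2 (gaussianReal 0 1) := by
  rw [memLp_two_iff_integrable_sq (by fun_prop)]
  convert gauss_int4 using 2
  ring

lemma gauss_var : Var[fun x : ℝ => x^2; gaussianReal 0 1] = 2 := by
  rw [variance_eq_sub gauss_memLp, gauss_mom.1]
  have : ∫ x, ((fun x : ℝ => x^2)^2) x ∂gaussianReal 0 1 = 3 := by
    rw [← gauss_mom.2]; congr 1; ext x; simp; ring
  rw [this]; norm_num

lemma cheb (N : ℕ) (hN : 0 < N) : (Measure.pi fun _ : Fin N => gaussianReal 0 1)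
    {g | ∑ y, (g y)^2 ≤ (N:ℝ)/2} ≤ ENNReal.ofReal (8 / N) := by
  set μ := Measure.pi fun _ : Fin N => gaussianReal 0 1 with hμ
  have hev : ∀ i : Fin N, MeasurePreserving (Function.eval i) μ (gaussianReal 0 1) :=
    fun i => measurePreserving_eval (fun _ : Fin N => gaussianReal 0 1) i
  have hi : ∀ i : Fin N, MemLp (fun g : Fin N → ℝ => (g i)^2) 2 μ := fun i =>
    gauss_memLp.comp_measurePreserving (hev i)
  have hL : MemLp (∑ i : Fin N, fun g : Fin N → ℝ => (g i)^2) 2 μ := 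
    memLp_finsetSum' _ fun i _ => hi i
  have hv : Var[∑ i : Fin N, fun g : Fin N → ℝ => (g i)^2; μ] = 2 * N := by
    rw [hμ, variance_sum_pi (X := fun _ x => x^2) fun i => gauss_memLp]
    simp [gauss_var]; ring
  have hE : ∫ g, (∑ i : Fin N, fun g : Fin N → ℝ => (g i)^2) g ∂μ = N := by
    simp only [Finset.sum_apply]
    rw [integral_finset_sum _ fun i _ => (hi i).integrable (by norm_num)]
    have : ∀ i : Fin N, ∫ g, (g i)^2 ∂μ = 1 := fun i => by
      rw [← gauss_mom.1]
      exact integral_comp_eval (μ := fun _ : Fin N => gaussianReal 0 1) (f := fun x : ℝ => x^2) (by fun_prop)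
    simp [this]
  have hN' : (0:ℝ) < N := by exact_mod_cast hN
  have := meas_ge_le_variance_div_sq hL (c := N/2) (by positivity)
  rw [hv, hE] at this
  refine (measure_mono ?_).trans (this.trans (le_of_eq ?_))
  · intro g hg
    simp only [Set.mem_setOf_eq, Finset.sum_apply] at hg ⊢
    rw [abs_sub_comm]
    exact le_trans (by linarith) (le_abs_self _)
  · congr 1; field_simp; norm_num

lemma mark (N : ℕ) : ∫⁻ g, ENNReal.ofReal (∑ y, (g y)^4) ∂(Measure.pi fun _ : Fin N => gaussianReal 0 1)
    = ENNReal.ofReal (3 * N) := by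
  have hi : ∀ i : Fin N, Integrable (fun g : Fin N → ℝ => (g i)^4) (Measure.pi fun _ : Fin N => gaussianReal 0 1) := fun i =>
    integrable_comp_eval (μ := fun _ : Fin N => gaussianReal 0 1) (f := fun x : ℝ => x^4) gauss_int4
  rw [← ofReal_integral_eq_lintegral_ofReal (integrable_finset_sum _ fun i _ => hi i)
    (Filter.Eventually.of_forall fun g => Finset.sum_nonneg fun i _ => by positivity),
    integral_finset_sum _ fun i _ => hi i]
  have : ∀ i : Fin N, ∫ g, (g i)^4 ∂(Measure.pi fun _ : Fin N => gaussianReal 0 1) = 3 := fun i => by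
      rw [← gauss_mom.2]
      exact integral_comp_eval (μ := fun _ : Fin N => gaussianReal 0 1) (f := fun x : ℝ => x^4) (by fun_prop)
  simp [this, mul_comm]

lemma coll (N m : ℕ) (p : Fin N → ℝ) (hp : ∀ x, 0 ≤ p x) (hs : ∑ x, p x = 1) :
    (Measure.pi fun _ : Fin m => ∑ x : Fin N, ENNReal.ofReal (p x) • Measure.dirac x)
      {z : Fin m → Fin N | ∃ i j : Fin m, i ≠ j ∧ z i = z j} ≤
    ENNReal.ofReal ((m:ℝ)^2 * ∑ x, (p x)^2) := by
  set ν : Measure (Fin N) := ∑ x : Fin N, ENNReal.ofReal (p x) • Measure.dirac x with hν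
  have hx : ∀ x, ν {x} = ENNReal.ofReal (p x) := by
    intro x
    simp [hν, Measure.finsetSum_apply, Set.indicator_apply]
  have hprob : IsProbabilityMeasure ν := by
    constructor
    simp [hν, Measure.finsetSum_apply]
    rw [← ENNReal.ofReal_sum_of_nonneg fun i _ => hp i, hs]; simp
  have hpair : ∀ i j : Fin m, (Measure.pi fun _ : Fin m => ν) {z | i ≠ j ∧ z i = z j} ≤ ENNReal.ofReal (∑ x, (p x)^2) := by
    intro i j
    by_cases hij : i = j
    · simp [hij]
    have hsub : {z : Fin m → Fin N | i ≠ j ∧ z i = z j} ⊆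
      ⋃ x : Fin N, Set.pi Set.univ (fun k => if k = i ∨ k = j then {x} else Set.univ) := by
      rintro z ⟨_, hz⟩
      simp only [Set.mem_iUnion, Set.mem_univ_pi]
      refine ⟨z i, fun k => ?_⟩
      split_ifs with h
      · rcases h with rfl | rfl <;> simp [hz]
      · simp
    refine (measure_mono hsub).trans ((measure_iUnion_fintype_le _ _).trans ?_)
    rw [ENNReal.ofReal_sum_of_nonneg fun i _ => by positivity]
    refine Finset.sum_le_sum fun x _ => ?_
    rw [Measure.pi_pi]
    have : ∀ k : Fin m, ν (if k = i ∨ k = j then {x} else Set.univ) = 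
        if k ∈ ({i, j} : Finset (Fin m)) then ENNReal.ofReal (p x) else 1 := by
      intro k
      by_cases h : k = i ∨ k = j
      · simp [h, hx]
      · simp [h]
    simp only [this]
    rw [Finset.prod_ite_mem, Finset.univ_inter, Finset.prod_const, Finset.card_pair hij,
      ENNReal.ofReal_pow (hp x)]
  have hU : {z : Fin m → Fin N | ∃ i j : Fin m, i ≠ j ∧ z i = z j} = ⋃ i : Fin m, ⋃ j : Fin m, {z | i ≠ j ∧ z i = z j} := by
    ext z; simp
  rw [hU]
  calc _ ≤ ∑ i : Fin m, ∑ j : Fin m, (Measure.pi fun _ : Fin m => ν) {z | i ≠ j ∧ z i = z j} :=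
        (measure_iUnion_fintype_le _ _).trans (Finset.sum_le_sum fun i _ => measure_iUnion_fintype_le _ _)
    _ ≤ ∑ i : Fin m, ∑ j : Fin m, ENNReal.ofReal (∑ x, (p x)^2) := 
        Finset.sum_le_sum fun i _ => Finset.sum_le_sum fun j _ => hpair i j
    _ = _ := by
      rw [ENNReal.ofReal_mul (by positivity)]
      simp [ENNReal.ofReal_pow]
      ring

theorem collision_of_samples_from_haar_measurement_whp (n N m : ℕ) (hn : 1 ≤ n)
    (hN : N = 2 ^ n) (h64 : 64 * n ≤ 2 ^ n) (hm : 1 ≤ m) :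
    ((Measure.pi fun _ : Fin N => gaussianReal 0 1).prod
        (Measure.pi fun _ : Fin N => gaussianReal 0 1))
      {ω | (Measure.pi fun _ : Fin m =>
              ∑ x : Fin N,
                ENNReal.ofReal
                  (((ω.1 x) ^ 2 + (ω.2 x) ^ 2) /
                    ((∑ y : Fin N, (ω.1 y) ^ 2) + ∑ y : Fin N, (ω.2 y) ^ 2)) •
                Measure.dirac x)
            {z : Fin m → Fin N | ∃ i j : Fin m, i ≠ j ∧ z i = z j} ≤
          ENNReal.ofReal (50 * (m : ℝ) ^ 2 * (2 : ℝ) ^ (-(n : ℝ) / 2))} ≥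
      ENNReal.ofReal (1 - (2 : ℝ) ^ (-(n : ℝ) / 2)) := by
  have hn10 : 10 ≤ n := by
    by_contra h
    push Not at h
    interval_cases n <;> omega
  set δ : ℝ := (2 : ℝ) ^ (-(n : ℝ) / 2) with hδ
  have hδ0 : 0 < δ := by positivity
  have hδN : δ^2 * N = 1 := by
    rw [hδ, ← Real.rpow_natCast, ← Real.rpow_mul (by norm_num), hN]
    push_cast
    rw [← Real.rpow_natCast 2 n, ← Real.rpow_add (by norm_num)]
    ring_nf; simp
  have hNn : 1024 ≤ N := by
    rw [hN]; calc 1024 = 2^10 := by norm_num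
      _ ≤ 2^n := Nat.pow_le_pow_right (by norm_num) hn10
  have hNR : (1024:ℝ) ≤ N := by exact_mod_cast hNn
  have hN0 : (0:ℝ) < N := by linarith
  have hδ32 : δ ≤ 1/32 := by
    by_contra h
    push Not at h
    nlinarith [mul_pos hδ0 hδ0]
  set μ := Measure.pi fun _ : Fin N => gaussianReal 0 1 with hμ
  set B1 : Set ((Fin N → ℝ) × (Fin N → ℝ)) := {ω | ∑ y, (ω.1 y)^2 ≤ (N:ℝ)/2}
  set B2 : Set ((Fin N → ℝ) × (Fin N → ℝ)) := {ω | ∑ y, (ω.2 y)^2 ≤ (N:ℝ)/2}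
  set B3 : Set ((Fin N → ℝ) × (Fin N → ℝ)) :=
    {ω | ENNReal.ofReal (12 * N / δ) ≤ ENNReal.ofReal (∑ y, (ω.1 y)^4) + ENNReal.ofReal (∑ y, (ω.2 y)^4)}
  have hms : MeasurableSet {g : Fin N → ℝ | ∑ y, (g y)^2 ≤ (N:ℝ)/2} :=
    measurableSet_le (by fun_prop) (by fun_prop)
  have hB1 : (μ.prod μ) B1 ≤ ENNReal.ofReal (8 / N) :=
    ((measurePreserving_fst (μ := μ) (ν := μ)).measure_preimage hms.nullMeasurableSet).trans_le (cheb N (by omega))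
  have hB2 : (μ.prod μ) B2 ≤ ENNReal.ofReal (8 / N) :=
    ((measurePreserving_snd (μ := μ) (ν := μ)).measure_preimage hms.nullMeasurableSet).trans_le (cheb N (by omega))
  have hmf : Measurable fun g : Fin N → ℝ => ENNReal.ofReal (∑ y, (g y)^4) := by fun_prop
  have hB3 : (μ.prod μ) B3 ≤ ENNReal.ofReal (δ / 2) := by
    have h1 := mul_meas_ge_le_lintegral (μ := μ.prod μ) (f := fun ω => ENNReal.ofReal (∑ y, (ω.1 y)^4) + ENNReal.ofReal (∑ y, (ω.2 y)^4)) (by fun_prop) (ENNReal.ofReal (12 * N / δ))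
    rw [lintegral_add_left (by fun_prop), (measurePreserving_fst (μ := μ) (ν := μ)).lintegral_comp hmf,
      (measurePreserving_snd (μ := μ) (ν := μ)).lintegral_comp hmf, mark, 
      ← ENNReal.ofReal_add (by positivity) (by positivity)] at h1
    have hpos : 0 < 12 * N / δ := by positivity
    have h2 := (ENNReal.le_div_iff_mul_le (a := (μ.prod μ) B3) (b := ENNReal.ofReal (12 * N / δ)) (c := ENNReal.ofReal (3 * N + 3 * N)) (Or.inl (ENNReal.ofReal_pos.2 hpos).ne') (Or.inl ENNReal.ofReal_ne_top)).2
      (by rw [mul_comm]; exact h1)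
    refine h2.trans (le_of_eq ?_)
    rw [← ENNReal.ofReal_div_of_pos hpos]
    congr 1; field_simp; norm_num
  have hmB : MeasurableSet (B1 ∪ B2 ∪ B3) := by
    refine (MeasurableSet.union ?_ ?_).union ?_ <;> exact measurableSet_le (by fun_prop) (by fun_prop)
  have hB : (μ.prod μ) (B1 ∪ B2 ∪ B3) ≤ ENNReal.ofReal δ := by
    refine (measure_union_le _ _).trans ((add_le_add ((measure_union_le _ _).trans (add_le_add hB1 hB2)) hB3).trans ?_)
    rw [← ENNReal.ofReal_add (by positivity) (by positivity), ← ENNReal.ofReal_add (by positivity) (by positivity)]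
    apply ENNReal.ofReal_le_ofReal
    have : 8 / (N:ℝ) = 8 * δ^2 := by field_simp; linarith
    rw [this]; nlinarith
  have hc : (μ.prod μ) (B1 ∪ B2 ∪ B3)ᶜ ≥ ENNReal.ofReal (1 - δ) := by
    rw [prob_compl_eq_one_sub hmB, ENNReal.ofReal_sub _ hδ0.le, ENNReal.ofReal_one]
    exact tsub_le_tsub_left hB 1
  refine hc.le.trans (measure_mono ?_)
  intro ω hω
  simp only [B1, B2, B3, Set.mem_compl_iff, Set.mem_union, Set.mem_setOf_eq, not_or, not_le] at hω
  obtain ⟨⟨h1, h2⟩, h3⟩ := hω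
  rw [← ENNReal.ofReal_add (Finset.sum_nonneg fun i _ => by positivity) (Finset.sum_nonneg fun i _ => by positivity),
    ENNReal.ofReal_lt_ofReal_iff (by positivity)] at h3
  rw [Set.mem_setOf_eq]
  set S := (∑ y : Fin N, (ω.1 y) ^ 2) + ∑ y : Fin N, (ω.2 y) ^ 2 with hS
  have hSN : (N:ℝ) ≤ S := by linarith
  have hS0 : 0 < S := by linarith
  refine (coll N m (fun x => ((ω.1 x) ^ 2 + (ω.2 x) ^ 2) / S) (fun x => by positivity) ?_).trans ?_
  · rw [← Finset.sum_div, Finset.sum_add_distrib, ← hS, div_self hS0.ne']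
  apply ENNReal.ofReal_le_ofReal
  have hQ : ∑ x, (((ω.1 x) ^ 2 + (ω.2 x) ^ 2) / S)^2 ≤ 50 * δ := by
    simp only [div_pow]
    rw [← Finset.sum_div, div_le_iff₀ (by positivity)]
    have hq : ∑ x, ((ω.1 x) ^ 2 + (ω.2 x) ^ 2)^2 ≤ 2 * (∑ y, (ω.1 y)^4 + ∑ y, (ω.2 y)^4) := by
      rw [← Finset.sum_add_distrib, Finset.mul_sum]
      refine Finset.sum_le_sum fun x _ => ?_
      nlinarith [sq_nonneg ((ω.1 x) ^ 2 - (ω.2 x) ^ 2)]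
    have he : 12 * N / δ = 12 * δ * N^2 := by
      field_simp; linear_combination (-1) * hδN
    have : (N:ℝ)^2 ≤ S^2 := by gcongr
    rw [he] at h3
    nlinarith [mul_le_mul_of_nonneg_left this hδ0.le, mul_pos hδ0 (pow_pos hS0 2)]
  nlinarith [mul_le_mul_of_nonneg_left hQ (sq_nonneg (m:ℝ))]
end

section
/- Let N ≥ 1 and 1 ≤ m ≤ N. Let μ be the law of m i.i.d. uniform samples from Fin N (i.e., the uniform distribution on the function type Fin m → Fin N), and let ν be the uniform distribution on the set of injective functions Fin m → Fin N (i.e., m uniformly random distinct elements of Fin N). Then the total variation distance between μ and ν is at most m²/N. -/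
open Finset

theorem desc_lower (N k : ℕ) (hk : k ≤ N) :
    (N : ℝ) ^ k * ((N : ℝ) - (k : ℝ) ^ 2) ≤ (Nat.descFactorial N k : ℝ) * N := by
  induction k with
  | zero => simp
  | succ k ih =>
    have ih' := ih (by omega)
    have hkN : k ≤ N := by omega
    rw [Nat.descFactorial_succ]
    push_cast [Nat.cast_sub hkN]
    have h1 : (0 : ℝ) ≤ (N : ℝ) - k := by
      have : (k : ℝ) ≤ N := by exact_mod_cast hkN
      linarith
    have h2 := mul_le_mul_of_nonneg_right ih' h1
    have h3 : (0 : ℝ) ≤ (N : ℝ) ^ k * ((N : ℝ) * (k + 1) + (k : ℝ) ^ 3) := by positivity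
    rw [pow_succ]
    nlinarith

theorem card_inj (N m : ℕ) :
    ((Finset.univ.filter (fun f : Fin m → Fin N => Function.Injective f)).card)
      = Nat.descFactorial N m := by
  rw [← Fintype.card_subtype,
    Fintype.card_congr (Equiv.subtypeInjectiveEquivEmbedding (Fin m) (Fin N))]
  simp [Fintype.card_embedding_eq]

/-- For `1 ≤ m ≤ N`, the total variation distance between the law `μ` of `m` i.i.d. uniform
samples from `Fin N` (uniform on `Fin m → Fin N`, mass `1/Nᵐ` each) and the uniform
distribution `ν` on injective functions `Fin m → Fin N` (mass `1/(N·(N−1)⋯(N−m+1))` on each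
injective function, `0` elsewhere) is at most `m²/N`. -/
theorem tv_uniform_vs_distinct (N m : ℕ) (hN : 1 ≤ N) (hm : 1 ≤ m) (hmN : m ≤ N) :
    (1 / 2 : ℝ) * ∑ f : Fin m → Fin N,
        |1 / (N : ℝ) ^ m -
          (if Function.Injective f then 1 / (Nat.descFactorial N m : ℝ) else 0)| ≤
      (m : ℝ) ^ 2 / N := by
  have hNpos : (0 : ℝ) < N := by exact_mod_cast hN
  have hD : (0 : ℝ) < (Nat.descFactorial N m : ℝ) := by
    exact_mod_cast Nat.descFactorial_pos.2 hmN
  have hP : (0 : ℝ) < (N : ℝ) ^ m := by positivity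
  have hle : (Nat.descFactorial N m : ℝ) ≤ (N : ℝ) ^ m := by
    exact_mod_cast Nat.descFactorial_le_pow N m
  have hinv : 1 / (N : ℝ) ^ m ≤ 1 / (Nat.descFactorial N m : ℝ) :=
    one_div_le_one_div_of_le hD hle
  have hterm : ∀ f : Fin m → Fin N,
      |1 / (N : ℝ) ^ m -
          (if Function.Injective f then 1 / (Nat.descFactorial N m : ℝ) else 0)| =
        1 / (N : ℝ) ^ m + (if Function.Injective f then
          (1 / (Nat.descFactorial N m : ℝ) - 2 * (1 / (N : ℝ) ^ m)) else 0) := by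
    intro f
    split_ifs
    · rw [abs_of_nonpos (by linarith)]; ring
    · rw [sub_zero, add_zero, abs_of_pos (by positivity)]
  rw [Finset.sum_congr rfl (fun f _ => hterm f), Finset.sum_add_distrib, ← Finset.sum_filter,
    Finset.sum_const, Finset.sum_const, card_inj]
  simp only [Finset.card_univ, Fintype.card_fun, Fintype.card_fin, nsmul_eq_mul, Nat.cast_pow]
  have hl := desc_lower N m hmN
  have e : (1 / 2 : ℝ) * ((N : ℝ) ^ m * (1 / (N : ℝ) ^ m) + (Nat.descFactorial N m : ℝ) *
      (1 / (Nat.descFactorial N m : ℝ) - 2 * (1 / (N : ℝ) ^ m)))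
      = 1 - (Nat.descFactorial N m : ℝ) / (N : ℝ) ^ m := by
    field_simp
    ring
  rw [e, sub_le_iff_le_add, div_add_div _ _ hNpos.ne' hP.ne', le_div_iff₀ (by positivity)]
  nlinarith
end
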